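/- arXiv:1607.03865 — 2 statements merged into one kernel-verified Lean document; each statement's English description precedes it below -/
import Mathlib

section
/- For every σ ∈ S_r, the generalized Bruhat stratum equals the union of the standard Bruhat strata over the corresponding coset of W_λ: as subsets of GL(r,ℂ), N^c_{λ,σ}·Π_σ·P_λ = ⋃_{π ∈ W_λ} N(r)·Π_{π∘σ}·B(r). In particular, GL(r,ℂ) is the disjoint union, over the cosets of W_λ in S_r, of the sets N^c_{λ,σ}·Π_σ·P_λ. -/
open Finset Matrix

/-- Partial sums of the sequence of parts `i 0, i 1, …`. -/
def psum (i : ℕ → ℕ) (l : ℕ) : ℕ := ∑ t ∈ Finset.range l, i t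

/-- The (0-indexed) block index of position `j ∈ {0,…,r-1}` with respect to the partition
with parts `i 0, …, i (s-1)`. -/
def blk (s : ℕ) (i : ℕ → ℕ) (j : ℕ) : ℕ :=
  ((Finset.range s).filter fun l => psum i (l + 1) ≤ j).card

/-- `N(r)`: complex lower triangular `r × r` matrices with all diagonal entries `1`. -/
def NN (r : ℕ) : Set (Matrix (Fin r) (Fin r) ℂ) :=
  {U | (∀ j, U j j = 1) ∧ ∀ j k : Fin r, (j : ℕ) < (k : ℕ) → U j k = 0}

/-- `B(r)`: invertible lower triangular complex matrices. -/
def BB (r : ℕ) : Set (Matrix (Fin r) (Fin r) ℂ) :=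
  {g | IsUnit g ∧ ∀ j k : Fin r, (j : ℕ) < (k : ℕ) → g j k = 0}

/-- `N_{λ,σ}`: matrices `U ∈ N(r)` with `U j k = 0` whenever `j > k` and
`b(σ j) < b(σ k)`. -/
def Nlam (r s : ℕ) (i : ℕ → ℕ) (σ : Fin r → Fin r) : Set (Matrix (Fin r) (Fin r) ℂ) :=
  {U | U ∈ NN r ∧ ∀ j k : Fin r, (k : ℕ) < (j : ℕ) →
    blk s i (σ j) < blk s i (σ k) → U j k = 0}

/-- `N^c_{λ,σ}`: matrices `U ∈ N(r)` with `U j k = 0` whenever `j > k` and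
`b(σ j) ≥ b(σ k)`. -/
def Nc (r s : ℕ) (i : ℕ → ℕ) (σ : Fin r → Fin r) : Set (Matrix (Fin r) (Fin r) ℂ) :=
  {U | U ∈ NN r ∧ ∀ j k : Fin r, (k : ℕ) < (j : ℕ) →
    blk s i (σ k) ≤ blk s i (σ j) → U j k = 0}

/-- The parabolic subgroup `P_λ`: invertible matrices `g` with `g j k = 0` whenever
`b(j) < b(k)`. -/
def Plam (r s : ℕ) (i : ℕ → ℕ) : Set (Matrix (Fin r) (Fin r) ℂ) :=
  {g | IsUnit g ∧ ∀ j k : Fin r, blk s i (j : ℕ) < blk s i (k : ℕ) → g j k = 0}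

/-- The Levi subgroup `D_λ`: invertible matrices `g` with `g j k = 0` whenever
`b(j) ≠ b(k)`. -/
def Dlam (r s : ℕ) (i : ℕ → ℕ) : Set (Matrix (Fin r) (Fin r) ℂ) :=
  {g | IsUnit g ∧ ∀ j k : Fin r, blk s i (j : ℕ) ≠ blk s i (k : ℕ) → g j k = 0}

/-- The permutation matrix `Π_σ`, with `(Π_σ)_{jk} = 1` iff `k = σ j`. -/
def permMat (r : ℕ) (σ : Fin r → Fin r) : Matrix (Fin r) (Fin r) ℂ :=
  Matrix.of fun j k => if σ j = k then 1 else 0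

/-- The single-block unipotent group `U_l` (here `a = i_1 + ⋯ + i_l`): matrices in `N(r)`
whose strictly-lower entries vanish except possibly in the lower-left block
`j > a ≥ k` (1-indexed), i.e. `a ≤ j ∧ k < a` (0-indexed). -/
def Ublock (r a : ℕ) : Set (Matrix (Fin r) (Fin r) ℂ) :=
  {U | U ∈ NN r ∧ ∀ j k : Fin r, (k : ℕ) < (j : ℕ) →
    ¬(a ≤ (j : ℕ) ∧ (k : ℕ) < a) → U j k = 0}

/-- The generalized Bruhat stratum `N^c_{λ,σ}·Π_σ·P_λ`. -/
def stratum (r s : ℕ) (i : ℕ → ℕ) (σ : Equiv.Perm (Fin r)) :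
    Set (Matrix (Fin r) (Fin r) ℂ) :=
  {g | ∃ L ∈ Nc r s i ⇑σ, ∃ P ∈ Plam r s i, g = L * permMat r ⇑σ * P}

theorem permMat_mul_apply {r : ℕ} (σ : Fin r → Fin r) (P : Matrix (Fin r) (Fin r) ℂ)
    (j k : Fin r) : (permMat r σ * P) j k = P (σ j) k := by
  simp [permMat, Matrix.mul_apply]

theorem mul_permMat_apply {r : ℕ} (σ : Equiv.Perm (Fin r)) (L : Matrix (Fin r) (Fin r) ℂ)
    (j k : Fin r) : (L * permMat r σ) j k = L j (σ.symm k) := by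
  simp only [permMat, Matrix.mul_apply, Matrix.of_apply, ← Equiv.eq_symm_apply]
  simp

theorem permMat_mul_permMat {r : ℕ} (σ π : Equiv.Perm (Fin r)) :
    permMat r σ * permMat r π = permMat r ⇑(π * σ : Equiv.Perm (Fin r)) := by
  ext j k
  rw [permMat_mul_apply]
  rfl

theorem isUnit_permMat {r : ℕ} (σ : Equiv.Perm (Fin r)) : IsUnit (permMat r σ) := by
  refine IsUnit.of_mul_eq_one (permMat r ⇑(σ⁻¹)) ?_
  rw [permMat_mul_permMat, inv_mul_cancel]
  ext j k
  by_cases h : j = k <;> simp [permMat, Matrix.one_apply, h]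

theorem blk_mono (s : ℕ) (i : ℕ → ℕ) : Monotone (blk s i) := by
  intro a b hab
  refine Finset.card_le_card fun l hl => ?_
  simp only [Finset.mem_filter] at hl ⊢
  exact ⟨hl.1, hl.2.trans hab⟩

/-- The inverse of an invertible matrix that is block lower triangular for a level function `c`
is block lower triangular for `c`. -/
theorem inv_apply_eq_zero_of_level_lt {r : ℕ} {c : Fin r → ℕ} {g : Matrix (Fin r) (Fin r) ℂ}
    (hu : IsUnit g) (hg : ∀ j k, c j < c k → g j k = 0) {j k : Fin r} (h : c j < c k) :
    g⁻¹ j k = 0 := by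
  have := hu.invertible
  have hg' : g.BlockTriangular (OrderDual.toDual ∘ c) := fun j k hjk => hg j k hjk
  exact blockTriangular_inv_of_blockTriangular hg' h

theorem mul_apply_eq_zero_of_level_lt {r : ℕ} {c : Fin r → ℕ} {g h : Matrix (Fin r) (Fin r) ℂ}
    (hg : ∀ j k, c j < c k → g j k = 0) (hh : ∀ j k, c j < c k → h j k = 0)
    {j k : Fin r} (hjk : c j < c k) : (g * h) j k = 0 := by
  have hg' : g.BlockTriangular (OrderDual.toDual ∘ c) := fun j k hjk => hg j k hjk
  have hh' : h.BlockTriangular (OrderDual.toDual ∘ c) := fun j k hjk => hh j k hjk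
  exact hg'.mul hh' hjk

theorem mul_mem_Plam {r s : ℕ} {i : ℕ → ℕ} {g h : Matrix (Fin r) (Fin r) ℂ}
    (hg : g ∈ Plam r s i) (hh : h ∈ Plam r s i) : g * h ∈ Plam r s i :=
  ⟨hg.1.mul hh.1, fun _ _ hjk =>
    mul_apply_eq_zero_of_level_lt (c := fun j => blk s i j) hg.2 hh.2 hjk⟩

theorem inv_mem_Plam {r s : ℕ} {i : ℕ → ℕ} {g : Matrix (Fin r) (Fin r) ℂ}
    (hg : g ∈ Plam r s i) : g⁻¹ ∈ Plam r s i :=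
  ⟨(Matrix.isUnit_nonsing_inv_iff).2 hg.1, fun _ _ hjk =>
    inv_apply_eq_zero_of_level_lt (c := fun j => blk s i j) hg.1 hg.2 hjk⟩

theorem BB_subset_Plam (r s : ℕ) (i : ℕ → ℕ) : BB r ⊆ Plam r s i := fun _ hg =>
  ⟨hg.1, fun j k hjk => hg.2 j k (lt_of_not_ge fun hkj => hjk.not_ge (blk_mono s i hkj))⟩

theorem permMat_mem_Plam {r s : ℕ} {i : ℕ → ℕ} {π : Equiv.Perm (Fin r)}
    (hπ : ∀ j : Fin r, blk s i (π j) = blk s i j) : permMat r π ∈ Plam r s i := by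
  refine ⟨isUnit_permMat π, fun j k hjk => ?_⟩
  have : π j ≠ k := by
    rintro rfl
    exact hjk.ne (hπ j).symm
  simp [permMat, this]

theorem isUnit_of_mem_NN {r : ℕ} {U : Matrix (Fin r) (Fin r) ℂ} (hU : U ∈ NN r) :
    IsUnit U := by
  rw [Matrix.isUnit_iff_isUnit_det, Matrix.det_of_isLowerTriangular U fun j k hjk => hU.2 j k hjk]
  simp [hU.1]

theorem mul_apply_self_of_lower {r : ℕ} {g h : Matrix (Fin r) (Fin r) ℂ}
    (hg : ∀ j k : Fin r, (j : ℕ) < k → g j k = 0) (hh : ∀ j k : Fin r, (j : ℕ) < k → h j k = 0)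
    (j : Fin r) : (g * h) j j = g j j * h j j := by
  rw [Matrix.mul_apply]
  refine Finset.sum_eq_single j (fun t _ ht => ?_) (by simp)
  rcases lt_or_gt_of_ne ht with h1 | h1
  · rw [hh t j h1, mul_zero]
  · rw [hg j t h1, zero_mul]

theorem mul_mem_NN {r : ℕ} {U V : Matrix (Fin r) (Fin r) ℂ} (hU : U ∈ NN r) (hV : V ∈ NN r) :
    U * V ∈ NN r :=
  ⟨fun j => by rw [mul_apply_self_of_lower hU.2 hV.2, hU.1, hV.1, one_mul],
    fun _ _ hjk => mul_apply_eq_zero_of_level_lt (c := fun j => (j : ℕ)) hU.2 hV.2 hjk⟩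

theorem inv_mem_NN {r : ℕ} {U : Matrix (Fin r) (Fin r) ℂ} (hU : U ∈ NN r) : U⁻¹ ∈ NN r := by
  have hlow : ∀ j k : Fin r, (j : ℕ) < k → U⁻¹ j k = 0 := fun _ _ hjk =>
    inv_apply_eq_zero_of_level_lt (c := fun j => (j : ℕ)) (isUnit_of_mem_NN hU) hU.2 hjk
  refine ⟨fun j => ?_, hlow⟩
  have h := mul_apply_self_of_lower hU.2 hlow j
  rw [Matrix.mul_nonsing_inv _ ((Matrix.isUnit_iff_isUnit_det _).1 (isUnit_of_mem_NN hU)),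
    hU.1, one_mul, Matrix.one_apply_eq] at h
  exact h.symm

/-- Every `U ∈ N(r)` can be multiplied on the right by an element of `N(r)` that is block
triangular with respect to `b ∘ σ` so as to land in `N^c_{λ,σ}`. -/
theorem exists_mul_mem_Nc {r s : ℕ} {i : ℕ → ℕ} (σ : Fin r → Fin r)
    {U : Matrix (Fin r) (Fin r) ℂ} (hU : U ∈ NN r) :
    ∃ M ∈ Nlam r s i σ, U * M ∈ Nc r s i σ := by
  have key : ∀ k : Fin r, ∃ x : Fin r → ℂ,
      (∀ j : Fin r, ¬ ((k : ℕ) < j ∧ blk s i (σ k) ≤ blk s i (σ j)) → x j = 0) ∧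
      ∀ j : Fin r, ((k : ℕ) < j ∧ blk s i (σ k) ≤ blk s i (σ j)) → (U *ᵥ x) j = - U j k := by
    classical
    intro k
    let p : Fin r → Prop := fun j => (k : ℕ) < j ∧ blk s i (σ k) ≤ blk s i (σ j)
    let A : Matrix (Fin r) (Fin r) ℂ :=
      Matrix.of fun j l => if p j then U j l else (1 : Matrix (Fin r) (Fin r) ℂ) j l
    have hA : A ∈ NN r := by
      refine ⟨fun j => ?_, fun j l hjl => ?_⟩
      · simp [A, hU.1]
      · have : j ≠ l := by
          rintro rfl
          exact lt_irrefl _ hjl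
        simp [A, hU.2 j l hjl, this]
    let v : Fin r → ℂ := fun j => if p j then - U j k else 0
    have hx : A *ᵥ (A⁻¹ *ᵥ v) = v := by
      rw [Matrix.mulVec_mulVec, Matrix.mul_nonsing_inv _
        ((Matrix.isUnit_iff_isUnit_det _).1 (isUnit_of_mem_NN hA)), Matrix.one_mulVec]
    refine ⟨A⁻¹ *ᵥ v, fun j hj => ?_, fun j hj => ?_⟩
    · have hrow : A j = (1 : Matrix (Fin r) (Fin r) ℂ) j := funext fun l => if_neg hj
      have h := congrFun hx j
      rw [Matrix.mulVec, hrow, ← Matrix.mulVec, Matrix.one_mulVec] at h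
      exact h.trans (if_neg hj)
    · have hrow : A j = U j := funext fun l => if_pos hj
      have h := congrFun hx j
      rw [Matrix.mulVec, hrow, ← Matrix.mulVec] at h
      exact h.trans (if_pos hj)
  choose x hx0 hx1 using key
  have hM : 1 + Matrix.of (fun j k => x k j) ∈ NN r := by
    refine ⟨fun j => ?_, fun j k hjk => ?_⟩
    · simp [hx0 j j fun h => lt_irrefl _ h.1]
    · have : j ≠ k := by
        rintro rfl
        exact lt_irrefl _ hjk
      simp [hx0 k j fun h => lt_asymm hjk h.1, this]
  refine ⟨1 + Matrix.of fun j k => x k j, ⟨hM, fun j k hkj hc => ?_⟩,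
    mul_mem_NN hU hM, fun j k hkj hc => ?_⟩
  · have : j ≠ k := by
      rintro rfl
      exact lt_irrefl _ hkj
    simp [hx0 k j fun h => h.2.not_gt hc, this]
  · have h : (U * Matrix.of fun j k => x k j) j k = (U *ᵥ x k) j := rfl
    rw [Matrix.mul_add, Matrix.mul_one, Matrix.add_apply, h, hx1 k j ⟨hkj, hc⟩]
    ring

/-- In the generalized Bruhat stratum, `N^c_{λ,σ}` may be replaced by all of `N(r)`. -/
theorem mem_stratum_iff {r s : ℕ} {i : ℕ → ℕ} {σ : Equiv.Perm (Fin r)}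
    {g : Matrix (Fin r) (Fin r) ℂ} :
    g ∈ stratum r s i σ ↔ ∃ L ∈ NN r, ∃ P ∈ Plam r s i, g = L * permMat r σ * P := by
  refine ⟨fun ⟨L, hL, P, hP, h⟩ => ⟨L, hL.1, P, hP, h⟩, ?_⟩
  rintro ⟨U, hU, P, hP, rfl⟩
  obtain ⟨M, hM, hUM⟩ := exists_mul_mem_Nc (s := s) (i := i) σ hU
  have hMu := isUnit_of_mem_NN hM.1
  have hlevel : ∀ j k, blk s i (σ j) < blk s i (σ k) → M j k = 0 := by
    intro j k hjk
    rcases lt_trichotomy (j : ℕ) k with h | h | h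
    · exact hM.1.2 j k h
    · obtain rfl := Fin.ext h
      exact absurd hjk (lt_irrefl _)
    · exact hM.2 j k h hjk
  have hQ : M⁻¹.submatrix σ.symm σ.symm ∈ Plam r s i := by
    refine ⟨(Matrix.isUnit_submatrix_equiv _ _).2 (Matrix.isUnit_nonsing_inv_iff.2 hMu),
      fun j k hjk => ?_⟩
    refine inv_apply_eq_zero_of_level_lt (c := fun j => blk s i (σ j)) hMu hlevel ?_
    simpa using hjk
  have hcomm : M⁻¹ * permMat r σ = permMat r σ * M⁻¹.submatrix σ.symm σ.symm := by
    ext j k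
    rw [permMat_mul_apply, mul_permMat_apply]
    simp
  refine ⟨U * M, hUM, M⁻¹.submatrix σ.symm σ.symm * P, mul_mem_Plam hQ hP, ?_⟩
  rw [← Matrix.mul_assoc, Matrix.mul_assoc (U * M), ← hcomm, ← Matrix.mul_assoc,
    Matrix.mul_nonsing_inv_cancel_right _ _ ((Matrix.isUnit_iff_isUnit_det _).1 hMu)]

/-- If two strata meet then their permutations lie in the same coset of `W_λ`. -/
theorem blk_eq_of_mem_stratum {r s : ℕ} {i : ℕ → ℕ} {σ σ' : Equiv.Perm (Fin r)}
    {g : Matrix (Fin r) (Fin r) ℂ} (h : g ∈ stratum r s i σ) (h' : g ∈ stratum r s i σ')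
    (j : Fin r) : blk s i (σ' j) = blk s i (σ j) := by
  obtain ⟨L, hL, P, hP, rfl⟩ := mem_stratum_iff.1 h
  obtain ⟨L', hL', P', hP', he⟩ := mem_stratum_iff.1 h'
  have hL'u := (Matrix.isUnit_iff_isUnit_det _).1 (isUnit_of_mem_NN hL')
  have hPu := (Matrix.isUnit_iff_isUnit_det _).1 hP.1
  have heq : (L'⁻¹ * L) * permMat r σ = permMat r σ' * (P' * P⁻¹) := by
    calc (L'⁻¹ * L) * permMat r σ
        = L'⁻¹ * (L * permMat r σ * P) * P⁻¹ := by
          simp only [Matrix.mul_assoc, Matrix.mul_nonsing_inv _ hPu, Matrix.mul_one]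
      _ = L'⁻¹ * L' * permMat r σ' * (P' * P⁻¹) := by
          rw [he]
          simp only [Matrix.mul_assoc]
      _ = permMat r σ' * (P' * P⁻¹) := by
          rw [Matrix.nonsing_inv_mul _ hL'u, Matrix.one_mul]
  have hQ := mul_mem_Plam hP' (inv_mem_Plam hP)
  have hN := mul_mem_NN (inv_mem_NN hL') hL
  have hle : ∀ j, blk s i (σ j) ≤ blk s i (σ' j) := by
    intro j
    by_contra! hlt
    have h1 := congrFun (congrFun heq j) (σ j)
    rw [mul_permMat_apply, permMat_mul_apply, Equiv.symm_apply_apply, hN.1,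
      hQ.2 _ _ hlt] at h1
    exact one_ne_zero h1
  have hsum : ∑ j, blk s i (σ j) = ∑ j, blk s i (σ' j) := by
    rw [Equiv.sum_comp σ fun j : Fin r => blk s i j, Equiv.sum_comp σ' fun j : Fin r => blk s i j]
  exact ((Finset.sum_eq_sum_iff_of_le fun j _ => hle j).1 hsum j (Finset.mem_univ j)).symm

theorem exists_perm_mul_of_mem_stratum {r s : ℕ} {i : ℕ → ℕ} {σ σ' : Equiv.Perm (Fin r)}
    {g : Matrix (Fin r) (Fin r) ℂ} (h : g ∈ stratum r s i σ) (h' : g ∈ stratum r s i σ') :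
    ∃ π : Equiv.Perm (Fin r), (∀ j : Fin r, blk s i (π j) = blk s i j) ∧ σ' = π * σ := by
  refine ⟨σ' * σ⁻¹, fun j => ?_, by group⟩
  simpa using blk_eq_of_mem_stratum h h' (σ⁻¹ j)

/-- The rows of an invertible matrix can be reduced by earlier rows until the positions of their
last nonzero entries form a permutation. -/
theorem exists_row_reduction {r : ℕ} {g : Matrix (Fin r) (Fin r) ℂ} (hg : IsUnit g) :
    ∃ L ∈ NN r, ∃ σ : Equiv.Perm (Fin r), ∀ j k : Fin r, σ j < k → (L * g) j k = 0 := by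
  classical
  let S : Fin r → ℕ → (Fin r → ℂ) → Prop := fun j n l =>
    l j = 1 ∧ (∀ k, j < k → l k = 0) ∧ ∀ m : Fin r, n ≤ m → (l ᵥ* g) m = 0
  have hex : ∀ j, ∃ n l, S j n l := fun j =>
    ⟨r, Pi.single j 1, by simp, fun k hk => Pi.single_eq_of_ne hk.ne' _,
      fun m hm => absurd m.2 hm.not_gt⟩
  let n : Fin r → ℕ := fun j => Nat.find (hex j)
  have hn : ∀ j, ∃ l, S j (n j) l := fun j => Nat.find_spec (hex j)
  have hmin : ∀ j m l, m < n j → ¬ S j m l := fun j m l hm hl => Nat.find_min (hex j) hm ⟨l, hl⟩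
  have hnr : ∀ j, n j ≤ r := fun j => Nat.find_min' (hex j)
    ⟨Pi.single j 1, by simp, fun k hk => Pi.single_eq_of_ne hk.ne' _,
      fun m hm => absurd m.2 hm.not_gt⟩
  choose l hl using hn
  have hpos : ∀ j, 0 < n j := by
    intro j
    rw [Nat.pos_iff_ne_zero]
    intro h0
    have hz : l j ᵥ* g = 0 ᵥ* g := by
      rw [Matrix.zero_vecMul]
      exact funext fun m => (hl j).2.2 m (by omega)
    have := congrFun (Matrix.vecMul_injective_of_isUnit hg hz) j
    rw [(hl j).1] at this
    exact one_ne_zero this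
  let f : Fin r → Fin r := fun j => ⟨n j - 1, by have := hnr j; have := hpos j; omega⟩
  have hlead : ∀ j, (l j ᵥ* g) (f j) ≠ 0 := by
    intro j h0
    refine hmin j (n j - 1) (l j) (by have := hpos j; omega) ⟨(hl j).1, (hl j).2.1, ?_⟩
    intro m hm
    rcases hm.eq_or_lt with h | h
    · rwa [show m = f j from Fin.ext h.symm]
    · exact (hl j).2.2 m (by omega)
  have hne : ∀ j k, k < j → f j ≠ f k := by
    intro j k hkj hf
    have hnk : n j = n k := by
      have h1 : n j - 1 = n k - 1 := congrArg Fin.val hf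
      have := hpos j
      have := hpos k
      omega
    set a := (l j ᵥ* g) (f j) / (l k ᵥ* g) (f k) with ha
    refine hmin j (n j - 1) (l j - a • l k) (by have := hpos j; omega) ⟨?_, ?_, ?_⟩
    · simp [(hl j).1, (hl k).2.1 j hkj]
    · intro t ht
      simp [(hl j).2.1 t ht, (hl k).2.1 t (hkj.trans ht)]
    · intro m hm
      rw [Matrix.sub_vecMul, Matrix.smul_vecMul, Pi.sub_apply, Pi.smul_apply, smul_eq_mul]
      rcases hm.eq_or_lt with h | h
      · have hmj : m = f j := Fin.ext h.symm
        have := hlead k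
        rw [ha, hmj, hf]
        field_simp
        ring
      · rw [(hl j).2.2 m (by omega), (hl k).2.2 m (by omega)]
        ring
  have hinj : Function.Injective f := by
    intro j k hf
    rcases lt_trichotomy j k with h | h | h
    · exact absurd hf.symm (hne k j h)
    · exact h
    · exact absurd hf (hne j k h)
  refine ⟨Matrix.of l, ⟨fun j => (hl j).1, fun j k hjk => (hl j).2.1 k hjk⟩,
    Equiv.ofBijective f (Finite.injective_iff_bijective.1 hinj), fun j k hjk => ?_⟩
  have hjk' : n j - 1 < k := hjk
  exact (hl j).2.2 k (by omega)

/-- The Bruhat decomposition `GL(r,ℂ) = ⋃ N(r)·Π_σ·B(r)`. -/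
theorem exists_bruhat {r : ℕ} {g : Matrix (Fin r) (Fin r) ℂ} (hg : IsUnit g) :
    ∃ σ : Equiv.Perm (Fin r), ∃ L ∈ NN r, ∃ B ∈ BB r, g = L * permMat r σ * B := by
  obtain ⟨L, hL, σ, h⟩ := exists_row_reduction hg
  have hLu := isUnit_of_mem_NN hL
  refine ⟨σ, L⁻¹, inv_mem_NN hL, (L * g).submatrix σ.symm id, ⟨?_, fun j k hjk => ?_⟩, ?_⟩
  · exact (Matrix.isUnit_submatrix_equiv (e₁ := σ.symm) (e₂ := Equiv.refl _)).2 (hLu.mul hg)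
  · exact h _ _ (by simpa using hjk)
  · have : permMat r σ * (L * g).submatrix σ.symm id = L * g := by
      ext j k
      rw [permMat_mul_apply]
      simp
    rw [Matrix.mul_assoc, this, ← Matrix.mul_assoc,
      Matrix.nonsing_inv_mul _ ((Matrix.isUnit_iff_isUnit_det _).1 hLu), Matrix.one_mul]

/-- For every `σ ∈ S_r`, the generalized Bruhat stratum equals the union of
the standard Bruhat strata over the corresponding coset of `W_λ`:
`N^c_{λ,σ}·Π_σ·P_λ = ⋃_{π ∈ W_λ} N(r)·Π_{π∘σ}·B(r)`. In particular, `GL(r,ℂ)` is the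
disjoint union, over the cosets of `W_λ` in `S_r`, of the sets `N^c_{λ,σ}·Π_σ·P_λ`. -/
theorem generalized_bruhat_decomposition (r s : ℕ) (i : ℕ → ℕ) (hr : 2 ≤ r)
    (hpos : ∀ l < s, 0 < i l) (hsum : psum i s = r) :
    (∀ σ : Equiv.Perm (Fin r),
      stratum r s i σ =
        ⋃ π ∈ {π : Equiv.Perm (Fin r) | ∀ j : Fin r, blk s i (π j) = blk s i j},
          {g | ∃ L ∈ NN r, ∃ B ∈ BB r, g = L * permMat r ⇑(π * σ) * B}) ∧
    (∀ g : Matrix (Fin r) (Fin r) ℂ, IsUnit g →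
      ∃ σ : Equiv.Perm (Fin r), g ∈ stratum r s i σ) ∧
    (∀ (σ σ' : Equiv.Perm (Fin r)) (g : Matrix (Fin r) (Fin r) ℂ),
      g ∈ stratum r s i σ → g ∈ stratum r s i σ' →
      ∃ π : Equiv.Perm (Fin r), (∀ j : Fin r, blk s i (π j) = blk s i j) ∧ σ' = π * σ) := by
  have hsub : ∀ (σ : Equiv.Perm (Fin r)) (g L B : Matrix (Fin r) (Fin r) ℂ), L ∈ NN r → B ∈ BB r →
      g = L * permMat r σ * B → g ∈ stratum r s i σ := fun σ g L B hL hB h =>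
    mem_stratum_iff.2 ⟨L, hL, B, BB_subset_Plam r s i hB, h⟩
  refine ⟨fun σ => Set.ext fun g => ?_, fun g hg => ?_,
    fun σ σ' g => exists_perm_mul_of_mem_stratum⟩
  · simp only [Set.mem_iUnion, Set.mem_ofPred_eq, exists_prop]
    constructor
    · intro hg
      have hu : IsUnit g := by
        obtain ⟨L, hL, P, hP, rfl⟩ := hg
        exact ((isUnit_of_mem_NN hL.1).mul (isUnit_permMat σ)).mul hP.1
      obtain ⟨τ, L, hL, B, hB, h⟩ := exists_bruhat hu
      obtain ⟨π, hπ, rfl⟩ := exists_perm_mul_of_mem_stratum hg (hsub τ g L B hL hB h)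
      exact ⟨π, hπ, L, hL, B, hB, h⟩
    · rintro ⟨π, hπ, L, hL, B, hB, rfl⟩
      refine mem_stratum_iff.2 ⟨L, hL, permMat r π * B,
        mul_mem_Plam (permMat_mem_Plam hπ) (BB_subset_Plam r s i hB), ?_⟩
      rw [← permMat_mul_permMat]
      simp only [Matrix.mul_assoc]
  · obtain ⟨σ, L, hL, B, hB, h⟩ := exists_bruhat hg
    exact ⟨σ, hsub σ g L B hL hB h⟩
end

section
/- Every matrix g ∈ GL(r,ℂ) admits an 'inverse Bruhat' factorization g = P·Π_σ^{-1}·L with σ ∈ S_r, P ∈ P_λ, and L ∈ N^c_{λ,σ}; moreover, for each fixed σ this factorization is unique: if P·Π_σ^{-1}·L = P'·Π_σ^{-1}·L' with P, P' ∈ P_λ and L, L' ∈ N^c_{λ,σ}, then P = P' and L = L'. -/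
open Finset Matrix

/-- A lower triangular matrix agreeing with the identity at the positions `(j, k)` with
`c k ≤ c j` has determinant one. -/
lemma det_eq_one_of_lower_of_graded {K : Type*} [Field K] {n : ℕ} {c : Fin n → ℕ}
    {X : Matrix (Fin n) (Fin n) K} (hlow : ∀ j k, j < k → X j k = 0)
    (hc : ∀ j k, c k ≤ c j → X j k = (1 : Matrix (Fin n) (Fin n) K) j k) : X.det = 1 := by
  rw [Matrix.det_of_isLowerTriangular X (fun j k h => hlow j k (OrderDual.toDual_lt_toDual.1 h))]
  exact Finset.prod_eq_one fun j _ => by simp [hc j j le_rfl]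

/-- Lower triangular matrices agreeing with the identity at the positions `(j, k)` with
`c k ≤ c j` are stable under inversion. -/
lemma inv_lower_graded {K : Type*} [Field K] {n : ℕ} {c : Fin n → ℕ}
    {X : Matrix (Fin n) (Fin n) K} (hlow : ∀ j k, j < k → X j k = 0)
    (hc : ∀ j k, c k ≤ c j → X j k = (1 : Matrix (Fin n) (Fin n) K) j k) :
    (∀ j k, j < k → X⁻¹ j k = 0) ∧
      ∀ j k, c k ≤ c j → X⁻¹ j k = (1 : Matrix (Fin n) (Fin n) K) j k := by
  have hdet : IsUnit X.det := by simp [det_eq_one_of_lower_of_graded hlow hc]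
  have hunit : IsUnit X := (Matrix.isUnit_iff_isUnit_det X).2 hdet
  have : Invertible X := hunit.invertible
  have hlow' : X⁻¹.BlockTriangular OrderDual.toDual :=
    Matrix.blockTriangular_inv_of_blockTriangular
      fun j k h => hlow j k (OrderDual.toDual_lt_toDual.1 h)
  have hne : ∀ j k, c k < c j → j ≠ k := by
    rintro j k h rfl
    exact lt_irrefl _ h
  have hblock : X⁻¹.BlockTriangular c :=
    Matrix.blockTriangular_inv_of_blockTriangular
      fun j k h => by rw [hc j k h.le, Matrix.one_apply_ne (hne j k h)]
  refine ⟨fun j k h => hlow' (OrderDual.toDual_lt_toDual.2 h), fun j k h => ?_⟩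
  rcases h.lt_or_eq with h | h
  · rw [hblock h, Matrix.one_apply_ne (hne j k h)]
  · rw [← Matrix.nonsing_inv_mul X hdet, Matrix.mul_apply, Finset.sum_eq_single k]
    · simp [hc k k le_rfl]
    · intro m _ hm
      rcases lt_or_ge (c m) (c j) with h' | h'
      · rw [hblock h', zero_mul]
      · rw [hc m k (h.trans_le h'), Matrix.one_apply_ne hm, mul_zero]
    · simp

/-- If `A * L = L'`, where `A` is graded by `c` in the direction opposite to `L` and `L'`,
then `A` is the identity. -/
lemma eq_one_of_mul_eq_of_graded {K : Type*} [Field K] {n : ℕ} {c : Fin n → ℕ}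
    {A L L' : Matrix (Fin n) (Fin n) K} (hA : ∀ j k, c j < c k → A j k = 0)
    (hlow : ∀ j k, j < k → L j k = 0)
    (hL : ∀ j k, c k ≤ c j → L j k = (1 : Matrix (Fin n) (Fin n) K) j k)
    (hL' : ∀ j k, c k ≤ c j → L' j k = (1 : Matrix (Fin n) (Fin n) K) j k)
    (h : A * L = L') : A = 1 := by
  have hdet : IsUnit L.det := by simp [det_eq_one_of_lower_of_graded hlow hL]
  have hinv := (inv_lower_graded hlow hL).2
  have hAL : A = L' * L⁻¹ := by rw [← h, Matrix.mul_nonsing_inv_cancel_right _ _ hdet]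
  ext j k
  rcases lt_or_ge (c j) (c k) with hjk | hjk
  · rw [hA j k hjk, Matrix.one_apply_ne (by rintro rfl; exact lt_irrefl _ hjk)]
  · rw [hAL, Matrix.mul_apply, Finset.sum_eq_single j]
    · simp [hL' j j le_rfl, hinv j k hjk]
    · intro m _ hm
      rcases le_or_gt (c m) (c j) with h' | h'
      · rw [hL' j m h', Matrix.one_apply_ne (Ne.symm hm), zero_mul]
      · rw [hinv m k (hjk.trans h'.le), Matrix.one_apply]
        split_ifs with hmk
        · subst hmk
          exact absurd hjk (not_le.2 h')
        · rw [mul_zero]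
    · simp

/-- For invertible `g` and a grading `b` of the rows, every column `k` has a largest degree
`c k` in which it can be placed by adding to it multiples of later columns. -/
lemma exists_maximal_degree {K : Type*} [Field K] {n : ℕ} (b : Fin n → ℕ)
    {g : Matrix (Fin n) (Fin n) K} (hg : IsUnit g) :
    ∃ c : Fin n → ℕ, ∀ k, IsGreatest
      {t | ∃ x : Fin n → K, x k = 1 ∧ (∀ j < k, x j = 0) ∧ ∀ m, b m < t → (g *ᵥ x) m = 0}
      (c k) := by
  refine Classical.skolem.1 fun k => ?_
  refine BddAbove.exists_isGreatest_of_nonempty ⟨Finset.univ.sup b, ?_⟩ ⟨0, Pi.single k 1, ?_⟩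
  · rintro t ⟨x, hxk, -, hx⟩
    by_contra! ht
    have h0 : g *ᵥ x = g *ᵥ 0 := by
      rw [Matrix.mulVec_zero]
      exact funext fun m => hx m ((Finset.le_sup (Finset.mem_univ m)).trans_lt ht)
    have := Matrix.mulVec_injective_iff_isUnit.2 hg h0
    simp [this] at hxk
  · refine ⟨by simp, fun j hj => by simp [hj.ne], by simp⟩

/-- A column operation realizing the maximal degree `c k` can be chosen to use only later
columns of strictly smaller maximal degree. -/
lemma exists_reduced_vector {K : Type*} [Field K] {n : ℕ} {b c : Fin n → ℕ}
    {g : Matrix (Fin n) (Fin n) K}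
    (hc : ∀ k, ∃ x : Fin n → K, x k = 1 ∧ (∀ j < k, x j = 0) ∧
      ∀ m, b m < c k → (g *ᵥ x) m = 0) (k : Fin n) :
    ∃ x : Fin n → K, x k = 1 ∧ (∀ j < k, x j = 0) ∧ (∀ m, b m < c k → (g *ᵥ x) m = 0) ∧
      ∀ j, k < j → c k ≤ c j → x j = 0 := by
  have key : ∀ N ≤ n, ∃ x : Fin n → K, x k = 1 ∧ (∀ j < k, x j = 0) ∧
      (∀ m, b m < c k → (g *ᵥ x) m = 0) ∧
      ∀ j : Fin n, (j : ℕ) < N → k < j → c k ≤ c j → x j = 0 := by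
    intro N
    induction N with
    | zero =>
      intro _
      obtain ⟨x, h1, h2, h3⟩ := hc k
      exact ⟨x, h1, h2, h3, by simp⟩
    | succ N ih =>
      intro hN
      obtain ⟨x, h1, h2, h3, h4⟩ := ih (by omega)
      set l : Fin n := ⟨N, hN⟩ with hl
      by_cases hkl : k < l ∧ c k ≤ c l
      · obtain ⟨y, y1, y2, y3⟩ := hc l
        refine ⟨x - x l • y, ?_, fun j hj => ?_, fun m hm => ?_, fun j hj hkj hcj => ?_⟩
        · simp [h1, y2 k hkl.1]
        · simp [h2 j hj, y2 j (hj.trans hkl.1)]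
        · simp [Matrix.mulVec_sub, Matrix.mulVec_smul, h3 m hm, y3 m (hm.trans_le hkl.2)]
        · rcases (Nat.lt_succ_iff.1 hj).lt_or_eq with hj | hj
          · have : j < l := hj
            simp [h4 j hj hkj hcj, y2 j this]
          · obtain rfl : j = l := Fin.ext hj
            simp [y1]
      · refine ⟨x, h1, h2, h3, fun j hj hkj hcj => ?_⟩
        rcases (Nat.lt_succ_iff.1 hj).lt_or_eq with hj | hj
        · exact h4 j hj hkj hcj
        · obtain rfl : j = l := Fin.ext hj
          exact absurd ⟨hkj, hcj⟩ hkl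
  obtain ⟨x, h1, h2, h3, h4⟩ := key n le_rfl
  exact ⟨x, h1, h2, h3, fun j => h4 j j.2⟩

/-- At least as many columns have maximal degree `≥ t` as there are rows of degree `≥ t`. -/
lemma card_le_card_maximal_degree {K : Type*} [Field K] {n : ℕ} {b c : Fin n → ℕ}
    {g : Matrix (Fin n) (Fin n) K} (hg : IsUnit g)
    (hc : ∀ k t, (∃ x : Fin n → K, x k = 1 ∧ (∀ j < k, x j = 0) ∧
      ∀ m, b m < t → (g *ᵥ x) m = 0) → t ≤ c k) (t : ℕ) :
    Fintype.card {m // t ≤ b m} ≤ Fintype.card {k // t ≤ c k} := by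
  have hdet := (Matrix.isUnit_iff_isUnit_det g).1 hg
  let φ : ({m // t ≤ b m} → K) →ₗ[K] ({k // t ≤ c k} → K) :=
    LinearMap.funLeft K K Subtype.val ∘ₗ Matrix.mulVecLin g⁻¹ ∘ₗ
      Function.ExtendByZero.linearMap K Subtype.val
  have hφ : Function.Injective φ := by
    rw [← LinearMap.ker_eq_bot, LinearMap.ker_eq_bot']
    intro y hy
    set z : Fin n → K := Function.extend Subtype.val y 0 with hz
    set x : Fin n → K := g⁻¹ *ᵥ z with hx
    have hgx : g *ᵥ x = z := by
      rw [hx, Matrix.mulVec_mulVec, Matrix.mul_nonsing_inv _ hdet, Matrix.one_mulVec]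
    have hxc : ∀ k, t ≤ c k → x k = 0 := fun k hk => congrFun hy ⟨k, hk⟩
    have hzb : ∀ m, b m < t → z m = 0 := fun m hm => by
      rw [hz, Function.extend_apply' _ _ _ (by rintro ⟨⟨a, ha⟩, rfl⟩; exact absurd hm (not_lt.2 ha))]
      rfl
    have hx0 : ∀ k, x k = 0 := by
      intro k
      induction k using WellFoundedLT.induction with
      | _ k ih =>
        by_contra hk
        refine hk (hxc k (hc k t ⟨(x k)⁻¹ • x, ?_, fun j hj => ?_, fun m hm => ?_⟩))
        · simp [hk]
        · simp [ih j hj]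
        · simp [Matrix.mulVec_smul, hgx, hzb m hm]
    have hz0 : z = 0 := by rw [← hgx, funext hx0]; exact Matrix.mulVec_zero g
    funext m
    have := congrFun hz0 m.1
    rwa [hz, Subtype.val_injective.extend_apply] at this
  simpa using LinearMap.finrank_le_finrank_of_injective hφ

/-- If an invertible matrix vanishes at the positions `(m, k)` with `b m < c k`, then `c k` is at
most `b (σ k)` for a suitable permutation `σ`. -/
lemma exists_perm_le_of_isUnit {K : Type*} [Field K] {n : ℕ} {b c : Fin n → ℕ}
    {M : Matrix (Fin n) (Fin n) K} (hM : IsUnit M) (h : ∀ m k, b m < c k → M m k = 0) :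
    ∃ σ : Equiv.Perm (Fin n), ∀ k, c k ≤ b (σ k) := by
  by_contra! hσ
  refine ((Matrix.isUnit_iff_isUnit_det M).1 hM).ne_zero ?_
  rw [Matrix.det_apply]
  refine Finset.sum_eq_zero fun σ _ => ?_
  obtain ⟨k, hk⟩ := hσ σ
  have hprod : ∏ j, M (σ j) j = 0 := Finset.prod_eq_zero (Finset.mem_univ k) (h _ _ hk)
  rw [hprod, smul_zero]

/-- Pointwise inequality up to a permutation is equality as soon as the superlevel sets of the
smaller function are at least as large. -/
lemma eq_comp_perm_of_card_le {n : ℕ} {b c : Fin n → ℕ} {σ : Equiv.Perm (Fin n)}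
    (hle : ∀ k, c k ≤ b (σ k))
    (hcard : ∀ t, Fintype.card {m // t ≤ b m} ≤ Fintype.card {k // t ≤ c k}) (k : Fin n) :
    c k = b (σ k) := by
  refine (hle k).antisymm ?_
  have hsub : (Finset.univ.filter fun j => b (σ k) ≤ c j) ⊆
      Finset.univ.filter fun j => b (σ k) ≤ b (σ j) :=
    fun j hj => by simp at hj ⊢; exact hj.trans (hle j)
  have heq := Finset.eq_of_subset_of_card_le hsub (by
    rw [← Fintype.card_subtype, ← Fintype.card_subtype]
    refine le_trans (le_of_eq ?_) (hcard (b (σ k)))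
    exact Fintype.card_congr (σ.subtypeEquiv fun _ => Iff.rfl))
  have : k ∈ Finset.univ.filter fun j => b (σ k) ≤ b (σ j) := by simp
  rw [← heq] at this
  simpa using this

lemma mem_Nc_iff {r s : ℕ} {i : ℕ → ℕ} {σ : Fin r → Fin r} {U : Matrix (Fin r) (Fin r) ℂ} :
    U ∈ Nc r s i σ ↔ (∀ j k, j < k → U j k = 0) ∧
      ∀ j k, blk s i (σ k) ≤ blk s i (σ j) → U j k = (1 : Matrix (Fin r) (Fin r) ℂ) j k := by
  constructor
  · rintro ⟨⟨hd, hu⟩, hl⟩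
    refine ⟨hu, fun j k h => ?_⟩
    rcases lt_trichotomy j k with hjk | rfl | hjk
    · rw [hu j k hjk, Matrix.one_apply_ne hjk.ne]
    · simp [hd]
    · rw [hl j k hjk h, Matrix.one_apply_ne hjk.ne']
  · rintro ⟨hu, hc⟩
    refine ⟨⟨fun j => by simp [hc j j le_rfl], hu⟩, fun j k hjk h => ?_⟩
    rw [hc j k h, Matrix.one_apply_ne (Fin.ne_of_gt hjk)]

lemma permMat_eq_submatrix (r : ℕ) (σ : Equiv.Perm (Fin r)) :
    permMat r σ = (1 : Matrix (Fin r) (Fin r) ℂ).submatrix σ id := by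
  ext j k
  simp [permMat, Matrix.one_apply]

lemma permMat_inv (r : ℕ) (σ : Equiv.Perm (Fin r)) :
    (permMat r σ)⁻¹ = (1 : Matrix (Fin r) (Fin r) ℂ).submatrix id σ := by
  refine Matrix.inv_eq_right_inv ?_
  rw [permMat_eq_submatrix, ← Matrix.submatrix_mul _ _ _ _ _ Function.bijective_id, mul_one,
    Matrix.submatrix_one_equiv]

lemma mul_permMat_inv {r : ℕ} (σ : Equiv.Perm (Fin r)) (P : Matrix (Fin r) (Fin r) ℂ) :
    P * (permMat r σ)⁻¹ = P.submatrix id σ := by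
  rw [permMat_inv]
  ext j k
  simp [Matrix.mul_apply, Matrix.one_apply]


/-- Every matrix `g ∈ GL(r,ℂ)` admits an "inverse Bruhat" factorization
`g = P·Π_σ⁻¹·L` with `σ ∈ S_r`, `P ∈ P_λ`, and `L ∈ N^c_{λ,σ}`; moreover, for each fixed `σ`
this factorization is unique. -/
theorem inverse_bruhat (r s : ℕ) (i : ℕ → ℕ) (hr : 2 ≤ r)
    (hpos : ∀ l < s, 0 < i l) (hsum : psum i s = r) :
    (∀ g : Matrix (Fin r) (Fin r) ℂ, IsUnit g →
      ∃ (σ : Equiv.Perm (Fin r)) (P L : Matrix (Fin r) (Fin r) ℂ),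
        P ∈ Plam r s i ∧ L ∈ Nc r s i ⇑σ ∧ g = P * (permMat r ⇑σ)⁻¹ * L) ∧
    (∀ (σ : Equiv.Perm (Fin r)) (P P' L L' : Matrix (Fin r) (Fin r) ℂ),
      P ∈ Plam r s i → P' ∈ Plam r s i → L ∈ Nc r s i ⇑σ → L' ∈ Nc r s i ⇑σ →
      P * (permMat r ⇑σ)⁻¹ * L = P' * (permMat r ⇑σ)⁻¹ * L' → P = P' ∧ L = L') := by
  refine ⟨fun g hg => ?_, fun σ P P' L L' hP hP' hL hL' h => ?_⟩
  · let b : Fin r → ℕ := fun m => blk s i m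
    obtain ⟨c, hc⟩ := exists_maximal_degree b hg
    choose x hx1 hx2 hx3 hx4 using exists_reduced_vector fun k => (hc k).1
    let X : Matrix (Fin r) (Fin r) ℂ := Matrix.of fun j k => x k j
    have hlow : ∀ j k, j < k → X j k = 0 := fun j k h => hx2 k j h
    have hXc : ∀ j k, c k ≤ c j → X j k = (1 : Matrix (Fin r) (Fin r) ℂ) j k := by
      intro j k h
      rcases lt_trichotomy j k with hjk | rfl | hjk
      · rw [hlow j k hjk, Matrix.one_apply_ne hjk.ne]
      · simp [X, hx1]
      · rw [Matrix.one_apply_ne hjk.ne']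
        exact hx4 k j hjk h
    have hXdet : IsUnit X.det := by simp [det_eq_one_of_lower_of_graded hlow hXc]
    have hM : IsUnit (g * X) := hg.mul ((Matrix.isUnit_iff_isUnit_det X).2 hXdet)
    have hMc : ∀ m k, b m < c k → (g * X) m k = 0 := fun m k h => hx3 k m h
    obtain ⟨σ, hσ⟩ := exists_perm_le_of_isUnit hM hMc
    have hcσ := eq_comp_perm_of_card_le hσ
      (card_le_card_maximal_degree hg fun k t ht => (hc k).2 ht)
    refine ⟨σ, (g * X).submatrix id σ.symm, X⁻¹, ⟨?_, fun j k h => ?_⟩, ?_, ?_⟩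
    · exact (Matrix.isUnit_submatrix_equiv (e₁ := Equiv.refl _) (e₂ := σ.symm)).2 hM
    · refine hMc _ _ ?_
      simpa [hcσ, b] using h
    · obtain ⟨h1, h2⟩ := inv_lower_graded hlow hXc
      exact mem_Nc_iff.2 ⟨h1, fun j k h => h2 j k (by simpa [hcσ, b] using h)⟩
    · rw [mul_permMat_inv, Matrix.submatrix_submatrix]
      simp [Matrix.mul_nonsing_inv_cancel_right _ _ hXdet]
  · rw [mem_Nc_iff] at hL hL'
    have hdetP' := (Matrix.isUnit_iff_isUnit_det P').1 hP'.1
    have hQ : (P'⁻¹ * P).BlockTriangular fun m : Fin r => OrderDual.toDual (blk s i m) := by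
      have : Invertible P' := hP'.1.invertible
      exact (Matrix.blockTriangular_inv_of_blockTriangular fun j k h => hP'.2 j k h).mul
        fun j k h => hP.2 j k h
    have hmul : (P'⁻¹ * P).submatrix σ σ * L = L' := by
      rw [mul_permMat_inv, mul_permMat_inv] at h
      have hsub : ∀ A B : Matrix (Fin r) (Fin r) ℂ, (P'⁻¹ * A).submatrix σ σ * B =
          (P'⁻¹ * (A.submatrix id σ * B)).submatrix σ id := fun A B => by
        rw [← Matrix.mul_assoc]
        rfl
      rw [hsub, h, ← hsub, Matrix.nonsing_inv_mul _ hdetP', Matrix.submatrix_one_equiv, one_mul]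
    have hone : (P'⁻¹ * P).submatrix σ σ = 1 := eq_one_of_mul_eq_of_graded (c := fun k => blk s i (σ k))
      (fun j k h => hQ h) hL.1 hL.2 hL'.2 hmul
    have hLL : L = L' := by rw [← hmul, hone, one_mul]
    have hQ1 : P'⁻¹ * P = 1 := by
      ext j k
      have hjk := congrFun (congrFun hone (σ.symm j)) (σ.symm k)
      rw [Matrix.submatrix_apply, σ.apply_symm_apply, σ.apply_symm_apply] at hjk
      rw [hjk]
      simp [Matrix.one_apply]
    refine ⟨?_, hLL⟩
    rw [← Matrix.mul_nonsing_inv_cancel_left P' P hdetP', hQ1, mul_one]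
end
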